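/- Let b₁, b₂ ∈ ℝ^d with ‖b₁ - b₂‖₂ ≤ ε', and let p be the density of N(0, σ²I_d) with σ = cε'/ε for c ≥ 1. Then with probability at least 1 - 1.5e^{-c²/2} over b₁ ~ p, it holds that e^{-ε} ≤ p(b₁)/p(b₂) ≤ e^{ε} (for ε ≤ 1, appropriately choosing c = √(2 log(1.5/δ)) gives failure probability δ). -/

import Mathlib

open MeasureTheory Real

lemma gdr_total {d : ℕ} (σ : ℝ) (hs : 0 < σ)
    (p : EuclideanSpace ℝ (Fin d) → ℝ)
    (hp : ∀ b, p b = (2 * π * σ ^ 2) ^ (-(d : ℝ) / 2) *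
      Real.exp (-‖b‖ ^ 2 / (2 * σ ^ 2))) :
    ∫⁻ b, ENNReal.ofReal (p b) = 1 := by
  have hb : 0 < 1 / (2 * σ ^ 2) := by positivity
  have h1 := GaussianFourier.integral_rexp_neg_mul_sq_norm
    (V := EuclideanSpace ℝ (Fin d)) hb
  have hI : ∫ b, p b = 1 := by
    have : ∀ b, p b = (2 * π * σ ^ 2) ^ (-(d : ℝ) / 2) *
        Real.exp (-(1 / (2 * σ ^ 2)) * ‖b‖ ^ 2) := by
      intro b; rw [hp b]; congr 2; ring
    simp_rw [this]
    rw [integral_const_mul, h1]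
    have h2 : π / (1 / (2 * σ ^ 2)) = 2 * π * σ ^ 2 := by field_simp
    have h3 : 0 < 2 * π * σ ^ 2 := by positivity
    rw [h2, ← Real.rpow_add h3]
    simp [neg_div]
  have hint : Integrable p := by
    by_contra h
    rw [integral_undef h] at hI
    exact zero_ne_one hI
  rw [← ofReal_integral_eq_lintegral_ofReal hint, hI, ENNReal.ofReal_one]
  refine Filter.Eventually.of_forall fun b => ?_
  simp only [Pi.zero_apply]
  rw [hp]; positivity

lemma gdr_half {d : ℕ} (p : EuclideanSpace ℝ (Fin d) → ℝ)
    (hm : Measurable p) (hpn : ∀ b, p (-b) = p b)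
    (h1 : ∫⁻ b, ENNReal.ofReal (p b) = 1) (w : EuclideanSpace ℝ (Fin d)) :
    ∫⁻ b in {b | 0 < inner ℝ b w}, ENNReal.ofReal (p b) ≤ ENNReal.ofReal (1 / 2) := by
  have hS : MeasurableSet {b : EuclideanSpace ℝ (Fin d) | 0 < inner ℝ b w} :=
    measurableSet_lt (by fun_prop) (by fun_prop)
  have hT : MeasurableSet {b : EuclideanSpace ℝ (Fin d) | inner ℝ b w < 0} :=
    measurableSet_lt (by fun_prop) (by fun_prop)
  have e : ∫⁻ b in {b | inner ℝ b w < 0}, ENNReal.ofReal (p b) =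
      ∫⁻ b in {b | 0 < inner ℝ b w}, ENNReal.ofReal (p b) := by
    rw [← lintegral_indicator hS, ← lintegral_indicator hT, ← lintegral_neg_eq_self]
    congr 1; ext b
    simp [Set.indicator_apply, hpn, inner_neg_left]
  have hd : Disjoint {b : EuclideanSpace ℝ (Fin d) | 0 < inner ℝ b w}
      {b : EuclideanSpace ℝ (Fin d) | inner ℝ b w < 0} := by
    rw [Set.disjoint_left]; intro b hb hb'
    simp only [Set.mem_ofPred_eq] at hb hb'
    linarith
  have h2 := lintegral_union (μ := volume) (f := fun b => ENNReal.ofReal (p b)) hT hd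
  have h3 := setLIntegral_le_lintegral (μ := volume)
    ({b : EuclideanSpace ℝ (Fin d) | 0 < inner ℝ b w} ∪ {b | inner ℝ b w < 0})
    (fun b => ENNReal.ofReal (p b))
  rw [h2, h1, e] at h3
  clear h2 e
  generalize (∫⁻ b in {b | 0 < inner ℝ b w}, ENNReal.ofReal (p b)) = x at h3 ⊢
  have hx : x ≠ ⊤ := by
    intro hx; rw [hx] at h3; simp at h3
  lift x to NNReal using hx
  rw [ENNReal.ofReal, ENNReal.coe_le_coe, ← NNReal.coe_le_coe]
  have h4 : x + x ≤ 1 := by exact_mod_cast h3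
  have h5 : (x : ℝ) + x ≤ 1 := by exact_mod_cast h4
  rw [Real.coe_toNNReal _ (by norm_num)]
  linarith

lemma gdr_tail {d : ℕ} (σ : ℝ) (hs : 0 < σ)
    (p : EuclideanSpace ℝ (Fin d) → ℝ)
    (hp : ∀ b, p b = (2 * π * σ ^ 2) ^ (-(d : ℝ) / 2) *
      Real.exp (-‖b‖ ^ 2 / (2 * σ ^ 2)))
    (w : EuclideanSpace ℝ (Fin d)) (hw : ‖w‖ = 1) (a : ℝ) (ha : 0 ≤ a) :
    ∫⁻ b in {b | a < inner ℝ b w}, ENNReal.ofReal (p b) ≤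
      ENNReal.ofReal (Real.exp (-a ^ 2 / (2 * σ ^ 2)) * (1 / 2)) := by
  have hm : Measurable p := by
    rw [funext hp]; fun_prop
  have hS : MeasurableSet {b : EuclideanSpace ℝ (Fin d) | 0 < inner ℝ b w} :=
    measurableSet_lt (by fun_prop) (by fun_prop)
  have hT : MeasurableSet {b : EuclideanSpace ℝ (Fin d) | a < inner ℝ b w} :=
    measurableSet_lt (by fun_prop) (by fun_prop)
  have hh := gdr_half p hm (by intro b; simp [hp]) (gdr_total σ hs p hp) w
  rw [ENNReal.ofReal_mul (Real.exp_pos _).le]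
  refine le_trans ?_ (mul_le_mul_right hh _)
  rw [← lintegral_indicator hS, ← lintegral_indicator hT,
    ← lintegral_const_mul' _ _ ENNReal.ofReal_ne_top,
    ← lintegral_add_right_eq_self _ (a • w)]
  refine lintegral_mono fun b => ?_
  have hi : inner ℝ (b + a • w) w = inner ℝ b w + a := by
    rw [inner_add_left, inner_smul_left, real_inner_self_eq_norm_sq, hw]; simp
  simp only [Set.indicator_apply, Set.mem_ofPred_eq, hi, lt_add_iff_pos_left]
  split_ifs with h
  · rw [← ENNReal.ofReal_mul (Real.exp_pos _).le]
    apply ENNReal.ofReal_le_ofReal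
    rw [hp, hp, mul_left_comm, ← Real.exp_add, ← add_div]
    gcongr
    rw [norm_add_sq_real, inner_smul_right, norm_smul, hw]
    have : 0 ≤ a * inner ℝ b w := mul_nonneg ha h.le
    simp only [mul_one, Real.norm_eq_abs, sq_abs]
    linarith
  · simp



/-- Gaussian mechanism density-ratio bound: if `b₁` is sampled from
`N(0, σ²I_d)` with `σ = cε'/ε` (`c ≥ 1`, `ε ≤ 1`), then for any shift `v` with
`‖v‖ ≤ ε'` (i.e. `b₂ = b₁ + v` with `‖b₁ - b₂‖ ≤ ε'`), the density ratio
`p(b₁)/p(b₂)` lies in `[e^{-ε}, e^{ε}]` with probability at least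
`1 - 1.5·e^{-c²/2}`. -/
theorem gaussian_density_ratio_whp {d : ℕ}
    (ε ε' c σ : ℝ) (hε : 0 < ε) (hε1 : ε ≤ 1) (hε' : 0 < ε')
    (hc : 1 ≤ c) (hσ : σ = c * ε' / ε)
    (p : EuclideanSpace ℝ (Fin d) → ℝ)
    (hp : ∀ b, p b = (2 * π * σ ^ 2) ^ (-(d : ℝ) / 2) *
      Real.exp (-‖b‖ ^ 2 / (2 * σ ^ 2)))
    (μ : Measure (EuclideanSpace ℝ (Fin d)))
    (hμ : μ = volume.withDensity fun b => ENNReal.ofReal (p b))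
    (v : EuclideanSpace ℝ (Fin d)) (hv : ‖v‖ ≤ ε') :
    ENNReal.ofReal (1 - 1.5 * Real.exp (-c ^ 2 / 2)) ≤
      μ {b | Real.exp (-ε) ≤ p b / p (b + v) ∧ p b / p (b + v) ≤ Real.exp ε} := by
  have hs : 0 < σ := by rw [hσ]; positivity
  have hk : c * ε' = ε * σ := by rw [hσ]; field_simp
  have htot := gdr_total σ hs p hp
  have hm : Measurable p := by
    rw [funext hp]; fun_prop
  have hratio : ∀ b, p b / p (b + v) =
      Real.exp ((2 * inner ℝ b v + ‖v‖ ^ 2) / (2 * σ ^ 2)) := by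
    intro b
    have hK : (2 * π * σ ^ 2) ^ (-(d : ℝ) / 2) ≠ 0 := by positivity
    rw [hp, hp, mul_div_mul_left _ _ hK, ← Real.exp_sub, norm_add_sq_real]
    congr 1; ring
  have h2s : 0 < 2 * σ ^ 2 := by positivity
  simp_rw [hratio, Real.exp_le_exp, le_div_iff₀ h2s, div_le_iff₀ h2s]
  have hμ1 : μ Set.univ = 1 := by
    rw [hμ, withDensity_apply _ MeasurableSet.univ, setLIntegral_univ, htot]
  have : IsProbabilityMeasure μ := ⟨hμ1⟩
  by_cases hv0 : v = 0
  · have : {b : EuclideanSpace ℝ (Fin d) | -ε * (2 * σ ^ 2) ≤ 2 * inner ℝ b v + ‖v‖ ^ 2 ∧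
        2 * inner ℝ b v + ‖v‖ ^ 2 ≤ ε * (2 * σ ^ 2)} = Set.univ := by
      ext b
      simp only [hv0, inner_zero_right, norm_zero, Set.mem_ofPred_eq, Set.mem_univ, iff_true]
      constructor <;> nlinarith [mul_pos hε h2s]
    rw [this, hμ1, ← ENNReal.ofReal_one]
    apply ENNReal.ofReal_le_ofReal
    linarith [Real.exp_pos (-c ^ 2 / 2)]
  have hvp : 0 < ‖v‖ := norm_pos_iff.mpr hv0
  set w := ‖v‖⁻¹ • v with hwdef
  have hw : ‖w‖ = 1 := by
    rw [hwdef, norm_smul, norm_inv, norm_norm, inv_mul_cancel₀ hvp.ne']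
  have hvw : ∀ b, inner ℝ b v = ‖v‖ * inner ℝ b w := by
    intro b
    rw [hwdef, inner_smul_right, mul_inv_cancel_left₀ hvp.ne']
  have hA : 0 ≤ c * σ - ε' / 2 := by nlinarith
  have t1 := gdr_tail σ hs p hp w hw _ hA
  have t2 := gdr_tail σ hs p hp (-w) (by rw [norm_neg, hw]) (c * σ) (by positivity)
  have hm1 : MeasurableSet {b : EuclideanSpace ℝ (Fin d) | c * σ - ε' / 2 < inner ℝ b w} :=
    measurableSet_lt (by fun_prop) (by fun_prop)
  have hm2 : MeasurableSet {b : EuclideanSpace ℝ (Fin d) | c * σ < inner ℝ b (-w)} :=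
    measurableSet_lt (by fun_prop) (by fun_prop)
  rw [← withDensity_apply _ hm1, ← hμ] at t1
  rw [← withDensity_apply _ hm2, ← hμ] at t2
  have hsub : ({b | c * σ - ε' / 2 < inner ℝ b w} ∪ {b | c * σ < inner ℝ b (-w)})ᶜ ⊆
      {b : EuclideanSpace ℝ (Fin d) | -ε * (2 * σ ^ 2) ≤ 2 * inner ℝ b v + ‖v‖ ^ 2 ∧
        2 * inner ℝ b v + ‖v‖ ^ 2 ≤ ε * (2 * σ ^ 2)} := by
    intro b hb
    simp only [Set.mem_compl_iff, Set.mem_union, Set.mem_ofPred_eq, not_or, not_lt,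
      inner_neg_right] at hb
    obtain ⟨hb1, hb2⟩ := hb
    simp only [Set.mem_ofPred_eq, hvw]
    have k1 := mul_le_mul_of_nonneg_left hb1 hvp.le
    have k2 := mul_le_mul_of_nonneg_left hb2 hvp.le
    have k3 : ‖v‖ * (c * σ) ≤ ε' * (c * σ) := by gcongr
    have k4 : ε' * (c * σ) = ε * σ ^ 2 := by linear_combination σ * hk
    have k5 : ‖v‖ * ‖v‖ ≤ ‖v‖ * ε' := by gcongr
    constructor <;> nlinarith
  refine le_trans ?_ (measure_mono hsub)
  rw [prob_compl_eq_one_sub (hm1.union hm2)]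
  have hu := (measure_union_le (μ := μ) _ _).trans (add_le_add t1 t2)
  rw [← ENNReal.ofReal_add (by positivity) (by positivity)] at hu
  refine le_trans ?_ (tsub_le_tsub_left hu 1)
  rw [← ENNReal.ofReal_one, ← ENNReal.ofReal_sub _ (by positivity)]
  apply ENNReal.ofReal_le_ofReal
  have e2 : Real.exp (-(c * σ) ^ 2 / (2 * σ ^ 2)) = Real.exp (-c ^ 2 / 2) := by
    congr 1; field_simp
  have e1 : Real.exp (-(c * σ - ε' / 2) ^ 2 / (2 * σ ^ 2)) ≤
      Real.exp (1 / 2) * Real.exp (-c ^ 2 / 2) := by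
    rw [← Real.exp_add, Real.exp_le_exp, div_le_iff₀ h2s]
    have k4 : ε' * (c * σ) = ε * σ ^ 2 := by linear_combination σ * hk
    nlinarith [sq_nonneg ε', sq_nonneg σ]
  have e3 : Real.exp (1 / 2) ≤ 2 := by
    have h : Real.exp (1 / 2) * Real.exp (1 / 2) = Real.exp 1 := by
      rw [← Real.exp_add]; norm_num
    nlinarith [Real.exp_one_lt_d9, Real.exp_pos (1 / 2)]
  have e4 : Real.exp (1 / 2) * Real.exp (-c ^ 2 / 2) ≤ 2 * Real.exp (-c ^ 2 / 2) := by gcongr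
  rw [e2]
  linarith
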